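/- Let $A$ be a Noetherian $\mathbb{Z}$-graded ring and $M$ a finitely generated graded $A$-module. Then the injective dimensions of $M$ in the category of graded $A$-modules and in the category of all $A$-modules satisfy $\mathrm{injdim}_{\mathrm{Gr}(A)}(M) \leq \mathrm{injdim}_{\mathrm{Mod}(A)}(M) \leq \mathrm{injdim}_{\mathrm{Gr}(A)}(M) + 1$. In particular, $M$ has finite injective dimension as a graded module if and only if it has finite injective dimension as an ordinary module. -/

import Mathlib

/- STATEMENT 9: For a Noetherian ℤ-graded ring `A` and a finitely generated graded
`A`-module `M`,
`injdim_{Gr(A)}(M) ≤ injdim_{Mod(A)}(M) ≤ injdim_{Gr(A)}(M) + 1`;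
in particular `M` has finite injective dimension as a graded module iff it does as an
ordinary module.  "Injective dimension `≤ n`" is expressed via iterated cosyzygies: for
`n = 0` it means being an injective object (for `Gr(A)`: the lifting property against graded
monomorphisms), and for `n + 1` it means embedding into an injective object so that the
cokernel has injective dimension `≤ n`. -/

universe u

/-- A graded module over the ℤ-graded ring `(A, 𝒜)`: a module with an exhaustive grading
compatible with the grading of `A`. -/
structure GrMod (A : Type u) [CommRing A] (𝒜 : ℤ → AddSubgroup A) where
  carrier : Type u
  [acg : AddCommGroup carrier]
  [mod : Module A carrier]
  grading : ℤ → AddSubgroup carrier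
  internal : DirectSum.IsInternal grading
  smul_mem : ∀ (i j : ℤ), ∀ a ∈ 𝒜 i, ∀ x ∈ grading j, a • x ∈ grading (i + j)

attribute [instance] GrMod.acg GrMod.mod

variable {A : Type u} [CommRing A] (𝒜 : ℤ → AddSubgroup A)

/-- A degree-preserving `A`-linear map between graded modules. -/
def IsGradedHom (M N : GrMod A 𝒜) (f : M.carrier →ₗ[A] N.carrier) : Prop :=
  ∀ i : ℤ, ∀ x ∈ M.grading i, f x ∈ N.grading i

/-- `M` is an injective object of the category `Gr(A)` of graded `A`-modules. -/
def GradedInjective (M : GrMod A 𝒜) : Prop :=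
  ∀ (N P : GrMod A 𝒜) (ι : N.carrier →ₗ[A] P.carrier),
    Function.Injective ι → IsGradedHom 𝒜 N P ι →
    ∀ g : N.carrier →ₗ[A] M.carrier, IsGradedHom 𝒜 N M g →
      ∃ h : P.carrier →ₗ[A] M.carrier, IsGradedHom 𝒜 P M h ∧ h.comp ι = g

/-- Injective dimension `≤ n` in the category `Gr(A)` of graded `A`-modules. -/
def grInjDimLE : ℕ → GrMod A 𝒜 → Prop
  | 0, M => GradedInjective 𝒜 M
  | n + 1, M =>
    ∃ I : GrMod A 𝒜, GradedInjective 𝒜 I ∧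
      ∃ f : M.carrier →ₗ[A] I.carrier, Function.Injective f ∧ IsGradedHom 𝒜 M I f ∧
        -- a graded cokernel of `f` has injective dimension `≤ n`
        ∃ (Q : GrMod A 𝒜) (π : I.carrier →ₗ[A] Q.carrier),
          Function.Surjective π ∧ LinearMap.ker π = LinearMap.range f ∧
          IsGradedHom 𝒜 I Q π ∧ grInjDimLE n Q

/-- Injective dimension `≤ n` in the category `Mod(A)` of all `A`-modules. -/
def modInjDimLE (A : Type u) [CommRing A] : ℕ → ModuleCat.{u} A → Prop
  | 0, X => Module.Injective A X
  | n + 1, X =>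
    ∃ I : ModuleCat.{u} A, Module.Injective A I ∧
      ∃ f : X →ₗ[A] I, Function.Injective f ∧
        modInjDimLE A n (ModuleCat.of A (I ⧸ LinearMap.range f))


set_option linter.unusedSectionVars false
set_option linter.unusedSimpArgs false

/-- functions `ℤ → X` with the twisted action of `A` -/
structure Tw (𝒜 : ℤ → AddSubgroup A) (X : Type*) where
  /-- the underlying function -/
  fn : ℤ → X

instance (X : Type*) : CoeFun (Tw 𝒜 X) (fun _ => ℤ → X) := ⟨Tw.fn⟩

/-- the underlying equivalence -/
def Tw.equiv (X : Type*) : Tw 𝒜 X ≃ (ℤ → X) where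
  toFun := Tw.fn
  invFun := Tw.mk
  left_inv _ := rfl
  right_inv _ := rfl

instance (X : Type*) [AddCommGroup X] : AddCommGroup (Tw 𝒜 X) := (Tw.equiv 𝒜 X).addCommGroup

section basics0
variable {𝒜}
variable {X Y : Type*} [AddCommGroup X] [AddCommGroup Y]

@[ext] theorem Tw.ext {x y : Tw 𝒜 X} (h : ∀ k, x k = y k) : x = y := by
  cases x; cases y; congr; exact funext h

@[simp] theorem Tw.mk_apply (x : ℤ → X) (k : ℤ) : (Tw.mk x : Tw 𝒜 X) k = x k := rfl
@[simp] theorem Tw.add_apply (x y : Tw 𝒜 X) (k : ℤ) : (x + y) k = x k + y k := rfl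
@[simp] theorem Tw.sub_apply (x y : Tw 𝒜 X) (k : ℤ) : (x - y) k = x k - y k := rfl
@[simp] theorem Tw.zero_apply (k : ℤ) : (0 : Tw 𝒜 X) k = 0 := rfl

/-- coordinate projection -/
def Tw.pr (𝒜 : ℤ → AddSubgroup A) (X : Type*) [AddCommGroup X] (k : ℤ) : Tw 𝒜 X →+ X where
  toFun x := x k
  map_zero' := rfl
  map_add' _ _ := rfl

@[simp] theorem Tw.pr_apply (x : Tw 𝒜 X) (k : ℤ) : Tw.pr 𝒜 X k x = x k := rfl

/-- additive map from its components -/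
def Tw.lift (𝒜 : ℤ → AddSubgroup A) (g : ℤ → (X →+ Y)) : X →+ Tw 𝒜 Y where
  toFun x := ⟨fun k => g k x⟩
  map_zero' := by ext; simp
  map_add' _ _ := by ext; simp

@[simp] theorem Tw.lift_apply (g : ℤ → (X →+ Y)) (x : X) (k : ℤ) : Tw.lift 𝒜 g x k = g k x := rfl

end basics0

/-- shift action of a homogeneous element -/
def twShift (X : Type*) [AddCommGroup X] [Module A X] (i : ℤ) :
    𝒜 i →+ AddMonoid.End (Tw 𝒜 X) where
  toFun a := Tw.lift 𝒜 (fun k => (DistribSMul.toAddMonoidHom X (a : A)).comp (Tw.pr 𝒜 X (k - i)))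
  map_zero' := by
    apply AddMonoidHom.ext; intro x; ext k
    change (0 : A) • x (k - i) = 0
    simp
  map_add' := by
    intro a b; apply AddMonoidHom.ext; intro x; ext k
    change ((a : A) + (b : A)) • x (k - i) = (a : A) • x (k - i) + (b : A) • x (k - i)
    rw [add_smul]

/-- the twisted action of `A` on `ℤ → X` -/
noncomputable def twHom [GradedRing 𝒜] (X : Type*) [AddCommGroup X] [Module A X] :
    A →+* AddMonoid.End (Tw 𝒜 X) :=
  (DirectSum.toSemiring (fun i => twShift 𝒜 X i)
    (by
      apply AddMonoidHom.ext; intro x; ext k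
      change (1 : A) • x (k - 0) = x k
      simp)
    (by
      intro i j a b
      apply AddMonoidHom.ext; intro x; ext k
      change ((a : A) * (b : A)) • x (k - (i + j)) = (a : A) • ((b : A) • x (k - i - j))
      rw [mul_smul]
      congr 3
      ring)).comp (DirectSum.decomposeRingEquiv 𝒜).toRingHom

noncomputable instance [GradedRing 𝒜] (X : Type*) [AddCommGroup X] [Module A X] :
    Module A (Tw 𝒜 X) :=
  Module.compHom (Tw 𝒜 X) (twHom 𝒜 X)

section basics
variable [GradedRing 𝒜] {X Y : Type*} [AddCommGroup X] [Module A X] [AddCommGroup Y] [Module A Y]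
variable {𝒜}

theorem Tw.smul_hom {i : ℤ} {a : A} (ha : a ∈ 𝒜 i) (x : Tw 𝒜 X) (k : ℤ) :
    (a • x) k = a • x (k - i) := by
  change (twHom 𝒜 X a : AddMonoid.End (Tw 𝒜 X)) x k = _
  have : DirectSum.decomposeRingEquiv 𝒜 a = DirectSum.of (fun i => 𝒜 i) i ⟨a, ha⟩ :=
    DirectSum.decompose_of_mem 𝒜 ha
  simp only [twHom, RingHom.comp_apply, RingEquiv.toRingHom_eq_coe, RingHom.coe_coe, this]
  exact congrArg (fun e : AddMonoid.End (Tw 𝒜 X) => (e x) k)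
    (DirectSum.toAddMonoid_of (fun i => twShift 𝒜 X i) i ⟨a, ha⟩)

theorem hom_induction {P : A → Prop} (h0 : P 0) (h1 : ∀ i, ∀ a ∈ 𝒜 i, P a)
    (h2 : ∀ a b, P a → P b → P (a + b)) (a : A) : P a :=
  DirectSum.Decomposition.inductionOn 𝒜 h0 (fun {i} a => h1 i a a.2) h2 a

/-- an additive map commuting with homogeneous scalars is linear -/
def mkLin (𝒜 : ℤ → AddSubgroup A) [GradedRing 𝒜] (f : X →+ Y)
    (h : ∀ i, ∀ a ∈ 𝒜 i, ∀ x, f (a • x) = a • f x) : X →ₗ[A] Y where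
  toFun := f
  map_add' := f.map_add
  map_smul' := by
    intro a x
    induction a using hom_induction (𝒜 := 𝒜) with
    | h0 => simp
    | h1 i a ha => exact h i a ha x
    | h2 a b iha ihb => simp only [add_smul, map_add, RingHom.id_apply] at *; rw [iha, ihb]

@[simp] theorem mkLin_apply (f : X →+ Y) (h) (x : X) : mkLin 𝒜 f h x = f x := rfl

/-- functoriality -/
noncomputable def Tw.map (𝒜 : ℤ → AddSubgroup A) [GradedRing 𝒜] (f : X →ₗ[A] Y) :
    Tw 𝒜 X →ₗ[A] Tw 𝒜 Y :=
  mkLin 𝒜 (Tw.lift 𝒜 (fun k => f.toAddMonoidHom.comp (Tw.pr 𝒜 X k)))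
    (by
      intro i a ha x
      ext k
      simp [Tw.smul_hom ha])

@[simp] theorem Tw.map_apply (f : X →ₗ[A] Y) (x : Tw 𝒜 X) (k : ℤ) : Tw.map 𝒜 f x k = f (x k) := rfl

/-- function supported at one point -/
def Tw.single (𝒜 : ℤ → AddSubgroup A) (i : ℤ) (x : X) : Tw 𝒜 X :=
  ⟨fun k => if k = i then x else 0⟩

theorem Tw.single_apply (i k : ℤ) (x : X) : Tw.single 𝒜 i x k = if k = i then x else 0 := rfl
@[simp] theorem Tw.single_same (i : ℤ) (x : X) : Tw.single 𝒜 i x i = x := by simp [single_apply]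

theorem Tw.single_add (i : ℤ) (x y : X) :
    Tw.single 𝒜 i (x + y) = Tw.single 𝒜 i x + Tw.single 𝒜 i y := by
  ext k; simp only [single_apply, Tw.add_apply]; split_ifs <;> simp

theorem Tw.single_zero (i : ℤ) : Tw.single 𝒜 i (0 : X) = 0 := by
  ext k; simp [single_apply]

theorem Tw.smul_single {i : ℤ} {a : A} (ha : a ∈ 𝒜 i) (j : ℤ) (x : X) :
    a • Tw.single 𝒜 j x = Tw.single 𝒜 (i + j) (a • x) := by
  ext k
  rw [Tw.smul_hom ha, single_apply, single_apply]
  have : k - i = j ↔ k = i + j := by omega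
  simp only [this]; split_ifs <;> simp

theorem Tw.smul_support_finite (a : A) (x : Tw 𝒜 X) (hx : (Function.support x).Finite) :
    (Function.support (a • x : Tw 𝒜 X)).Finite := by
  induction a using hom_induction (𝒜 := 𝒜) with
  | h0 => rw [zero_smul]; simp [Function.support]
  | h1 i a ha =>
    refine (hx.image (fun k => k + i)).subset ?_
    intro k hk
    refine ⟨k - i, ?_, by simp⟩
    intro h0
    apply hk
    simp [Tw.smul_hom ha, h0]
  | h2 a b iha ihb =>
    rw [add_smul]
    refine (iha.union ihb).subset ?_
    exact Function.support_add _ _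

/-- the grading defined by a coaction -/
def coGrading {M : Type*} [AddCommGroup M] [Module A M] (δ : M →ₗ[A] Tw 𝒜 M) (i : ℤ) :
    AddSubgroup M where
  carrier := {x | δ x = Tw.single 𝒜 i x}
  zero_mem' := by simp [Tw.single_zero]
  add_mem' := by
    intro x y hx hy
    simp only [Set.mem_ofPred_eq] at *
    rw [map_add, hx, hy, Tw.single_add]
  neg_mem' := by
    intro x hx
    simp only [Set.mem_ofPred_eq] at *
    rw [map_neg, hx, neg_eq_iff_add_eq_zero, ← Tw.single_add, add_neg_cancel, Tw.single_zero]

variable (𝒜) in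
/-- a graded module from a coaction -/
def GrMod.ofCoaction (M : Type u) [AddCommGroup M] [Module A M] (δ : M →ₗ[A] Tw 𝒜 M)
    (h1 : ∀ x i, δ (δ x i) = Tw.single 𝒜 i (δ x i))
    (h2 : ∀ x, (Function.support (δ x)).Finite)
    (h3 : ∀ x, ∑ᶠ i, δ x i = x) : GrMod A 𝒜 where
  carrier := M
  grading := coGrading δ
  internal := by
    classical
    constructor
    · rw [injective_iff_map_eq_zero]
      intro v hv
      ext i
      have key : ∀ w : DirectSum ℤ (fun i => coGrading δ i),
          δ (DirectSum.coeAddMonoidHom (coGrading δ) w) i = (w i : M) := by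
        intro w
        induction w using DirectSum.induction_on with
        | zero => simp
        | of j y =>
          rw [DirectSum.coeAddMonoidHom_of]
          have hy : δ (y : M) = Tw.single 𝒜 j (y : M) := y.2
          rw [hy, Tw.single_apply, DirectSum.of_apply]
          by_cases hij : i = j
          · subst hij; simp
          · have : ¬ j = i := fun h => hij h.symm
            simp [hij, this]
        | add x y hx hy => simp only [map_add, Tw.add_apply, hx, hy, DirectSum.add_apply]; rfl
      rw [← key, hv]; simp
    · intro x
      refine ⟨∑ i ∈ (h2 x).toFinset, DirectSum.of _ i ⟨δ x i, h1 x i⟩, ?_⟩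
      rw [map_sum]
      simp only [DirectSum.coeAddMonoidHom_of]
      conv_rhs => rw [← h3 x]
      rw [finsum_eq_sum_of_support_toFinset_subset _ (h2 x) le_rfl]
  smul_mem := by
    intro i j a ha x hx
    change δ (a • x) = _
    have hx : δ x = Tw.single 𝒜 j x := hx
    rw [map_smul, hx, Tw.smul_single ha]

theorem GrMod.mem_ofCoaction {M : Type u} [AddCommGroup M] [Module A M] {δ : M →ₗ[A] Tw 𝒜 M}
    {h1 h2 h3} {i : ℤ} {x : M} :
    x ∈ (GrMod.ofCoaction 𝒜 M δ h1 h2 h3).grading i ↔ δ x = Tw.single 𝒜 i x := Iff.rfl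

/-- component additive maps -/
noncomputable def GrMod.dec (M : GrMod A 𝒜) : M.carrier →+ DirectSum ℤ (fun i => M.grading i) :=
  (AddEquiv.ofBijective _ M.internal).symm.toAddMonoidHom

theorem GrMod.dec_mem (M : GrMod A 𝒜) {i : ℤ} {x : M.carrier} (hx : x ∈ M.grading i) :
    M.dec x = DirectSum.of (fun i => M.grading i) i ⟨x, hx⟩ := by
  apply M.internal.injective
  refine ((AddEquiv.ofBijective _ M.internal).apply_symm_apply x).trans ?_
  simp

theorem GrMod.induction (M : GrMod A 𝒜) {P : M.carrier → Prop} (h0 : P 0)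
    (h1 : ∀ i, ∀ a ∈ M.grading i, P a)
    (h2 : ∀ a b, P a → P b → P (a + b)) (a : M.carrier) : P a := by
  classical
  obtain ⟨v, rfl⟩ := M.internal.surjective a
  induction v using DirectSum.induction_on with
  | zero => simpa using h0
  | of i x => simpa using h1 i x x.2
  | add x y hx hy => rw [map_add]; exact h2 _ _ hx hy

/-- the coaction of a graded module -/
noncomputable def GrMod.δ (M : GrMod A 𝒜) : M.carrier →ₗ[A] Tw 𝒜 M.carrier :=
  mkLin 𝒜 (Tw.lift 𝒜 (fun k =>
      { toFun := fun x => (M.dec x k : M.carrier)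
        map_zero' := by simp
        map_add' := by intro x y; simp }))
    (by
      classical
      intro i a ha x
      ext k
      rw [Tw.smul_hom ha]
      simp only [Tw.lift_apply, AddMonoidHom.coe_mk, ZeroHom.coe_mk]
      induction x using M.induction with
      | h0 => simp
      | h1 j x hx =>
        rw [M.dec_mem hx, M.dec_mem (M.smul_mem i j a ha x hx)]
        rw [DirectSum.of_apply, DirectSum.of_apply]
        by_cases hk : i + j = k
        · obtain rfl := hk
          have : j = i + j - i := by ring
          rw [dif_pos rfl, dif_pos this]
          simp only
          congr 1
          generalize_proofs
          revert this
          generalize i + j - i = l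
          rintro rfl
          rfl
        · have : ¬ j = k - i := by omega
          simp [hk, this]
      | h2 x y hx hy => simp [smul_add, hx, hy])

theorem GrMod.δ_mem (M : GrMod A 𝒜) (x : M.carrier) (i : ℤ) : M.δ x i ∈ M.grading i :=
  (M.dec x i).2

theorem GrMod.mem_iff (M : GrMod A 𝒜) {x : M.carrier} {i : ℤ} :
    x ∈ M.grading i ↔ M.δ x = Tw.single 𝒜 i x := by
  classical
  constructor
  · intro hx
    ext k
    change (M.dec x k : M.carrier) = _
    rw [M.dec_mem hx, DirectSum.of_apply, Tw.single_apply]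
    by_cases hk : i = k
    · subst hk; simp
    · have : ¬ k = i := fun h => hk h.symm
      simp [hk, this]
  · intro h
    have := M.δ_mem x i
    rw [h] at this
    simpa using this

theorem GrMod.δ_finite (M : GrMod A 𝒜) (x : M.carrier) : (Function.support (M.δ x)).Finite := by
  classical
  refine (M.dec x).support.finite_toSet.subset ?_
  intro i hi
  simp only [Finset.mem_coe, DFinsupp.mem_support_toFun]
  intro h
  apply hi
  change (M.dec x i : M.carrier) = 0
  rw [h]; rfl

theorem GrMod.δ_sum (M : GrMod A 𝒜) (x : M.carrier) : ∑ᶠ i, M.δ x i = x := by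
  induction x using M.induction with
  | h0 => simp
  | h1 i x hx =>
    rw [M.mem_iff.1 hx, finsum_eq_single _ i]
    · simp
    · intro k hk; simp [Tw.single_apply, hk]
  | h2 x y hx hy =>
    simp only [map_add, Tw.add_apply]
    rw [finsum_add_distrib (M.δ_finite x) (M.δ_finite y), hx, hy]

theorem GrMod.δ_δ (M : GrMod A 𝒜) (x : M.carrier) (i : ℤ) : M.δ (M.δ x i) = Tw.single 𝒜 i (M.δ x i) :=
  M.mem_iff.1 (M.δ_mem x i)

theorem isGradedHom_iff {M N : GrMod A 𝒜} {f : M.carrier →ₗ[A] N.carrier} :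
    IsGradedHom 𝒜 M N f ↔ ∀ x k, N.δ (f x) k = f (M.δ x k) := by
  constructor
  · intro h x k
    induction x using M.induction with
    | h0 => simp
    | h1 i x hx =>
      rw [M.mem_iff.1 hx, N.mem_iff.1 (h i x hx)]
      simp only [Tw.single_apply]; split_ifs <;> simp
    | h2 x y hx hy => simp [hx, hy]
  · intro h i x hx
    rw [N.mem_iff]
    ext k
    rw [h, M.mem_iff.1 hx]
    simp only [Tw.single_apply]; split_ifs <;> simp

theorem GrMod.δ_ofCoaction {M : Type u} [AddCommGroup M] [Module A M] {δ : M →ₗ[A] Tw 𝒜 M}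
    {h1 h2 h3} (x : M) : (GrMod.ofCoaction 𝒜 M δ h1 h2 h3).δ x = δ x := by
  let G := GrMod.ofCoaction 𝒜 M δ h1 h2 h3
  change G.δ (x : G.carrier) = _
  induction x using G.induction with
  | h0 => rw [map_zero]; exact δ.map_zero.symm
  | h1 i x hx => rw [G.mem_iff.1 hx]; exact (show δ x = Tw.single 𝒜 i x from hx).symm
  | h2 x y hx hy => rw [map_add, hx, hy]; exact (δ.map_add x y).symm

end basics


section objects
variable [GradedRing 𝒜]

/-- finitely supported elements -/
def Rsub (X : Type*) [AddCommGroup X] [Module A X] : Submodule A (Tw 𝒜 X) where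
  carrier := {x | (Function.support x.fn).Finite}
  zero_mem' := by
    change (Function.support (fun _ => (0 : X))).Finite
    simp
  add_mem' := by
    intro x y hx hy
    exact (hx.union hy).subset (Function.support_add _ _)
  smul_mem' := by
    intro a x hx
    exact Tw.smul_support_finite a x hx

theorem Tw.single_support (i : ℤ) {X : Type*} [AddCommGroup X] [Module A X] (x : X) :
    (Function.support (Tw.single 𝒜 i x).fn).Finite := by
  refine (Set.finite_singleton i).subset ?_
  intro k hk
  by_contra h
  apply hk
  exact if_neg h

variable (X : Type u) [AddCommGroup X] [Module A X]

/-- coaction on `Rsub` -/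
noncomputable def Rδ : Rsub 𝒜 X →ₗ[A] Tw 𝒜 (Rsub 𝒜 X) :=
  mkLin 𝒜 (Tw.lift 𝒜 (fun k =>
    { toFun := fun x => ⟨Tw.single 𝒜 k (x.1 k), Tw.single_support 𝒜 k _⟩
      map_zero' := by ext1; simp [Tw.single_zero]
      map_add' := by intro x y; ext1; simp [Tw.single_add] }))
    (by
      intro i a ha x
      ext k : 1
      rw [Tw.smul_hom ha]
      ext1
      simp only [Tw.lift_apply, AddMonoidHom.coe_mk, ZeroHom.coe_mk, Submodule.coe_smul,
        Tw.smul_hom ha, Tw.smul_single ha]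
      congr 1
      ring)

theorem Rδ_apply (x : Rsub 𝒜 X) (k : ℤ) : (Rδ 𝒜 X x k).1 = Tw.single 𝒜 k (x.1 k) := rfl

/-- right adjoint to the forgetful functor -/
noncomputable def RX : GrMod A 𝒜 := GrMod.ofCoaction 𝒜 (Rsub 𝒜 X) (Rδ 𝒜 X)
  (by
    intro x i
    ext k : 1
    ext1
    rw [Rδ_apply, Rδ_apply, Tw.single_apply]
    by_cases h : k = i
    · subst h; simp [Tw.single_apply, Rδ_apply]
    · simp [Tw.single_apply, h, Tw.single_zero])
  (by
    intro x
    have hx : (Function.support x.1.fn).Finite := x.2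
    refine hx.subset ?_
    intro k hk h0
    apply hk
    ext1
    have h0 : x.1.fn k = 0 := h0
    rw [Rδ_apply, h0, Tw.single_zero]; rfl)
  (by
    intro x
    have hx : (Function.support x.1.fn).Finite := x.2
    have hs : (Function.support (Rδ 𝒜 X x).fn) ⊆ (hx.toFinset : Set ℤ) := by
      intro k hk
      simp only [Set.Finite.coe_toFinset]
      intro h0
      apply hk
      ext1
      have h0 : x.1.fn k = 0 := h0
      rw [Rδ_apply, h0, Tw.single_zero]; rfl
    rw [finsum_eq_sum_of_support_subset _ hs]
    ext1
    ext k
    rw [← Tw.pr_apply]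
    simp only [AddSubmonoidClass.coe_finsetSum, map_sum, Rδ_apply, Tw.pr_apply, Tw.single_apply]
    rw [Finset.sum_ite_eq]
    split_ifs with h
    · rfl
    · simpa [eq_comm] using h)

variable {X}
variable {Y Z : Type u} [AddCommGroup Y] [Module A Y] [AddCommGroup Z] [Module A Z]
variable {𝒜}

/-- underlying function -/
noncomputable def RX.val : (RX 𝒜 X).carrier →ₗ[A] Tw 𝒜 X := (Rsub 𝒜 X).subtype

theorem RX.ext {x y : (RX 𝒜 X).carrier} (h : ∀ k, RX.val x k = RX.val y k) : x = y :=
  Subtype.ext (Tw.ext h)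

theorem RX.finite (x : (RX 𝒜 X).carrier) : (Function.support (RX.val x).fn).Finite :=
  (show Rsub 𝒜 X from x).2

variable (𝒜) in
/-- constructor -/
def RX.mk (x : ℤ → X) (hx : (Function.support x).Finite) : (RX 𝒜 X).carrier :=
  (⟨⟨x⟩, hx⟩ : Rsub 𝒜 X)

@[simp] theorem RX.val_mk (x : ℤ → X) (hx) (k : ℤ) : RX.val (RX.mk 𝒜 x hx) k = x k := rfl

theorem RX.val_δ (x : (RX 𝒜 X).carrier) (k : ℤ) :
    RX.val ((RX 𝒜 X).δ x k) = Tw.single 𝒜 k (RX.val x k) := by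
  have : (RX 𝒜 X).δ x = Rδ 𝒜 X x := GrMod.δ_ofCoaction (M := Rsub 𝒜 X) x
  rw [this]; rfl

variable (𝒜) in
/-- one point support -/
def RX.single (k : ℤ) : X →+ (RX 𝒜 X).carrier where
  toFun x := (⟨Tw.single 𝒜 k x, Tw.single_support 𝒜 k _⟩ : Rsub 𝒜 X)
  map_zero' := Subtype.ext (Tw.single_zero k)
  map_add' x y := Subtype.ext (Tw.single_add k x y)

theorem RX.val_single (k : ℤ) (x : X) : RX.val (RX.single 𝒜 k x) = Tw.single 𝒜 k x := rfl

theorem RX.val_single_apply (k l : ℤ) (x : X) :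
    RX.val (RX.single 𝒜 k x) l = if l = k then x else 0 := rfl

theorem RX.smul_single {i : ℤ} {a : A} (ha : a ∈ 𝒜 i) (k : ℤ) (x : X) :
    a • RX.single 𝒜 k x = RX.single 𝒜 (i + k) (a • x) := by
  apply RX.ext; intro l
  rw [map_smul, RX.val_single, RX.val_single, Tw.smul_single ha]

theorem RX.single_mem (k : ℤ) (x : X) : RX.single 𝒜 k x ∈ (RX 𝒜 X).grading k := by
  rw [GrMod.mem_iff]
  ext l : 1
  apply RX.ext; intro m
  rw [RX.val_δ, Tw.single_apply, Tw.single_apply, RX.val_single_apply]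
  by_cases h : l = k
  · subst h; simp [RX.val_single_apply]
  · simp [h]

theorem RX.eq_single {k : ℤ} {x : (RX 𝒜 X).carrier} (hx : x ∈ (RX 𝒜 X).grading k) :
    x = RX.single 𝒜 k (RX.val x k) := by
  apply RX.ext; intro l
  have h := RX.val_δ x k
  rw [(GrMod.mem_iff _).1 hx, Tw.single_same] at h
  rw [RX.val_single, ← h]

/-- maps out of `RX` -/
noncomputable def RX.sum (g : ℤ → Y →+ Z)
    (hg : ∀ i, ∀ a ∈ 𝒜 i, ∀ k y, g (i + k) (a • y) = a • g k y) : (RX 𝒜 Y).carrier →ₗ[A] Z :=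
  mkLin 𝒜
    { toFun := fun x => ∑ᶠ k, g k (RX.val x k)
      map_zero' := by simp
      map_add' := by
        intro x y
        simp only [map_add, Tw.add_apply]
        apply finsum_add_distrib
        · refine (RX.finite x).subset ?_
          intro k hk h0
          exact hk (by simp only [h0, map_zero])
        · refine (RX.finite y).subset ?_
          intro k hk h0
          exact hk (by simp only [h0, map_zero]) }
    (by
      intro i a ha x
      simp only [AddMonoidHom.coe_mk, ZeroHom.coe_mk]
      rw [← finsum_comp_equiv (Equiv.addLeft i)]
      simp only [map_smul, Tw.smul_hom ha, Equiv.coe_addLeft, hg i a ha, add_sub_cancel_left]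
      refine ((DistribSMul.toAddMonoidHom Z a).map_finsum ?_).symm
      refine (RX.finite x).subset ?_
      intro k hk h0
      exact hk (by simp only [h0, map_zero]))

theorem RX.sum_apply (g : ℤ → Y →+ Z) (hg : ∀ i, ∀ a ∈ 𝒜 i, ∀ k y, g (i + k) (a • y) = a • g k y)
    (x : (RX 𝒜 Y).carrier) : RX.sum g hg x = ∑ᶠ k, g k (RX.val x k) := rfl

theorem RX.sum_single (g : ℤ → Y →+ Z) (hg : ∀ i, ∀ a ∈ 𝒜 i, ∀ k y, g (i + k) (a • y) = a • g k y)
    (k : ℤ) (y : Y) : RX.sum g hg (RX.single 𝒜 k y) = g k y := by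
  rw [RX.sum_apply, finsum_eq_single _ k]
  · simp [RX.val_single_apply]
  · intro l hl; simp [RX.val_single_apply, hl]

theorem RX.sum_graded (E : GrMod A 𝒜) (g : ℤ → Y →+ E.carrier)
    (hg : ∀ i, ∀ a ∈ 𝒜 i, ∀ k y, g (i + k) (a • y) = a • g k y)
    (h : ∀ k y, g k y ∈ E.grading k) : IsGradedHom 𝒜 (RX 𝒜 Y) E (RX.sum g hg) := by
  intro i x hx
  rw [RX.eq_single hx, RX.sum_single]
  exact h _ _

/-- map into `RX` -/
noncomputable def RX.lift (N : GrMod A 𝒜) (g : N.carrier →ₗ[A] X) :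
    N.carrier →ₗ[A] (RX 𝒜 X).carrier :=
  LinearMap.codRestrict (Rsub 𝒜 X) (Tw.map 𝒜 g ∘ₗ N.δ) (by
    intro x
    refine (N.δ_finite x).subset ?_
    intro k hk h0
    apply hk
    simp [h0])

@[simp] theorem RX.val_lift (N : GrMod A 𝒜) (g : N.carrier →ₗ[A] X) (n : N.carrier) (k : ℤ) :
    RX.val (RX.lift N g n) k = g (N.δ n k) := rfl

theorem RX.lift_graded (N : GrMod A 𝒜) (g : N.carrier →ₗ[A] X) :
    IsGradedHom 𝒜 N (RX 𝒜 X) (RX.lift N g) := by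
  rw [isGradedHom_iff]
  intro x k
  apply RX.ext; intro l
  rw [RX.val_δ, RX.val_lift, RX.val_lift, N.δ_δ, Tw.single_apply, Tw.single_apply]
  split_ifs <;> simp

/-- functoriality -/
noncomputable def RX.map (f : X →ₗ[A] Y) : (RX 𝒜 X).carrier →ₗ[A] (RX 𝒜 Y).carrier :=
  LinearMap.codRestrict (Rsub 𝒜 Y) (Tw.map 𝒜 f ∘ₗ RX.val) (by
    intro x
    refine (RX.finite x).subset ?_
    intro k hk h0
    apply hk
    simp [h0])

@[simp] theorem RX.val_map (f : X →ₗ[A] Y) (x : (RX 𝒜 X).carrier) (k : ℤ) :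
    RX.val (RX.map f x) k = f (RX.val x k) := rfl

theorem RX.map_single (f : X →ₗ[A] Y) (k : ℤ) (x : X) :
    RX.map f (RX.single 𝒜 k x) = RX.single 𝒜 k (f x) := by
  apply RX.ext; intro l
  simp only [RX.val_map, RX.val_single_apply]; split_ifs <;> simp

theorem RX.map_graded (f : X →ₗ[A] Y) : IsGradedHom 𝒜 (RX 𝒜 X) (RX 𝒜 Y) (RX.map f) := by
  intro i x hx
  rw [RX.eq_single hx, RX.map_single]
  exact RX.single_mem _ _

theorem RX.map_injective (f : X →ₗ[A] Y) (hf : Function.Injective f) :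
    Function.Injective (RX.map (𝒜 := 𝒜) f) := by
  intro x y h
  apply RX.ext; intro k
  apply hf
  rw [← RX.val_map, ← RX.val_map, h]

theorem RX.map_surjective (f : X →ₗ[A] Y) (hf : Function.Surjective f) :
    Function.Surjective (RX.map (𝒜 := 𝒜) f) := by
  classical
  intro y
  choose g hg using hf
  refine ⟨RX.mk 𝒜 (fun k => if RX.val y k = 0 then 0 else g (RX.val y k)) ?_, ?_⟩
  · refine (RX.finite y).subset ?_
    intro k hk h0
    exact hk (if_pos h0)
  · apply RX.ext; intro k
    rw [RX.val_map, RX.val_mk]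
    split_ifs with h
    · simp [h]
    · exact hg _

theorem RX.map_exact (f : X →ₗ[A] Y) (g : Y →ₗ[A] Z) (hf : Function.Injective f)
    (h : ∀ y, g y = 0 → ∃ x, f x = y) (y : (RX 𝒜 Y).carrier) (hy : RX.map g y = 0) :
    ∃ x, RX.map f x = y := by
  have : ∀ k, ∃ x, f x = RX.val y k := by
    intro k
    apply h
    rw [← RX.val_map, hy]; simp
  choose x hx using this
  refine ⟨RX.mk 𝒜 x ?_, ?_⟩
  · refine (RX.finite y).subset ?_
    intro k hk h0
    apply hk
    apply hf
    rw [hx, h0, map_zero]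
  · apply RX.ext; intro k
    rw [RX.val_map, RX.val_mk, hx]

/-- counit -/
noncomputable def RX.eps : (RX 𝒜 X).carrier →ₗ[A] X :=
  RX.sum (fun _ => AddMonoidHom.id X) (by intros; rfl)

theorem RX.gradedInjective (hX : Module.Injective A X) : GradedInjective 𝒜 (RX 𝒜 X) := by
  intro N P ι hι hιg g hg
  obtain ⟨h, hh⟩ := hX.out ι hι (RX.eps ∘ₗ g)
  refine ⟨RX.lift P h, RX.lift_graded P h, ?_⟩
  ext n : 1
  apply RX.ext; intro k
  rw [LinearMap.comp_apply, RX.val_lift, isGradedHom_iff.1 hιg, hh, LinearMap.comp_apply,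
    RX.eq_single (hg k _ (N.δ_mem n k)), RX.eps, RX.sum_single, ← isGradedHom_iff.1 hg,
    RX.val_δ]
  simp

/-- the retraction -/
noncomputable def RX.retr (M : GrMod A 𝒜) : (RX 𝒜 M.carrier).carrier →ₗ[A] M.carrier :=
  RX.sum (fun k => (Tw.pr 𝒜 M.carrier k).comp M.δ.toAddMonoidHom) (by
    intro i a ha k y
    simp [Tw.smul_hom ha])

theorem RX.retr_graded (M : GrMod A 𝒜) : IsGradedHom 𝒜 _ _ (RX.retr M) :=
  RX.sum_graded _ _ _ (fun k y => M.δ_mem y k)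

theorem RX.retr_lift (M : GrMod A 𝒜) (x : M.carrier) :
    RX.retr M (RX.lift M LinearMap.id x) = x := by
  conv_rhs => rw [← M.δ_sum x]
  change ∑ᶠ k, M.δ (M.δ x k) k = _
  simp only [M.δ_δ, Tw.single_same]

theorem exists_factor {P Q N : Type*} [AddCommGroup P] [AddCommGroup Q] [AddCommGroup N]
    [Module A P] [Module A Q] [Module A N] (π : P →ₗ[A] Q) (hπ : Function.Surjective π)
    (g : P →ₗ[A] N) (h : ∀ x, π x = 0 → g x = 0) : ∃ g' : Q →ₗ[A] N, ∀ x, g' (π x) = g x := by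
  refine ⟨(LinearMap.ker π).liftQ g (fun x hx => h x hx) ∘ₗ
    (π.quotKerEquivOfSurjective hπ).symm.toLinearMap, fun x => ?_⟩
  have : (π.quotKerEquivOfSurjective hπ).symm (π x) = Submodule.Quotient.mk x := by
    rw [LinearEquiv.symm_apply_eq]; rfl
  simp only [LinearMap.comp_apply, LinearEquiv.coe_coe, this]
  rfl

theorem factor_graded {P Q N : GrMod A 𝒜} (π : P.carrier →ₗ[A] Q.carrier)
    (hπ : Function.Surjective π) (hπg : IsGradedHom 𝒜 P Q π)
    (g : P.carrier →ₗ[A] N.carrier) (hg : IsGradedHom 𝒜 P N g) (g' : Q.carrier →ₗ[A] N.carrier)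
    (h : ∀ x, g' (π x) = g x) : IsGradedHom 𝒜 Q N g' := by
  rw [isGradedHom_iff] at *
  intro x k
  obtain ⟨y, rfl⟩ := hπ x
  rw [h, hg, hπg, h]

theorem exists_quot (M : GrMod A 𝒜) (S : Submodule A M.carrier)
    (hS : ∀ x ∈ S, ∀ k, M.δ x k ∈ S) :
    ∃ (Q : GrMod A 𝒜) (π : M.carrier →ₗ[A] Q.carrier), Function.Surjective π ∧
      LinearMap.ker π = S ∧ IsGradedHom 𝒜 M Q π := by
  obtain ⟨δ', hδ'⟩ := exists_factor S.mkQ S.mkQ_surjective (Tw.map 𝒜 S.mkQ ∘ₗ M.δ) (by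
    intro x hx
    ext k
    have hx : x ∈ S := by simpa using hx
    simpa using hS x hx k)
  let Q : GrMod A 𝒜 := GrMod.ofCoaction 𝒜 (M.carrier ⧸ S) δ'
    (by
      intro x i
      obtain ⟨x, rfl⟩ := S.mkQ_surjective x
      rw [hδ', LinearMap.comp_apply, Tw.map_apply, hδ', LinearMap.comp_apply, M.δ_δ]
      ext k
      simp only [Tw.map_apply, Tw.single_apply]; split_ifs <;> simp)
    (by
      intro x
      obtain ⟨x, rfl⟩ := S.mkQ_surjective x
      rw [hδ']
      refine (M.δ_finite x).subset ?_
      intro k hk h0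
      apply hk
      simp [h0])
    (by
      intro x
      obtain ⟨x, rfl⟩ := S.mkQ_surjective x
      rw [hδ']
      conv_rhs => rw [← M.δ_sum x]
      exact (S.mkQ.toAddMonoidHom.map_finsum (M.δ_finite x)).symm)
  refine ⟨Q, S.mkQ, S.mkQ_surjective, S.ker_mkQ, ?_⟩
  intro i x hx
  change δ' (S.mkQ x) = Tw.single 𝒜 i (S.mkQ x)
  rw [hδ', LinearMap.comp_apply, M.mem_iff.1 hx]
  ext k
  simp only [Tw.map_apply, Tw.single_apply]; split_ifs <;> simp

theorem exists_sub (M : GrMod A 𝒜) (S : Submodule A M.carrier)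
    (hS : ∀ x ∈ S, ∀ k, M.δ x k ∈ S) :
    ∃ (N : GrMod A 𝒜) (ι : N.carrier →ₗ[A] M.carrier), Function.Injective ι ∧
      LinearMap.range ι = S ∧ IsGradedHom 𝒜 N M ι := by
  let δ' : S →ₗ[A] Tw 𝒜 S := mkLin 𝒜 (Tw.lift 𝒜 (fun k =>
    { toFun := fun x => ⟨M.δ x.1 k, hS x.1 x.2 k⟩
      map_zero' := by ext1; simp
      map_add' := by intro x y; ext1; simp }))
    (by
      intro i a ha x
      ext k : 1
      rw [Tw.smul_hom ha]
      ext1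
      simp [Tw.smul_hom ha])
  have hδ' : ∀ x k, (δ' x k).1 = M.δ x.1 k := fun x k => rfl
  let N : GrMod A 𝒜 := GrMod.ofCoaction 𝒜 S δ'
    (by
      intro x i
      ext k : 1
      ext1
      rw [hδ', hδ', M.δ_δ, Tw.single_apply, Tw.single_apply]; split_ifs <;> simp [hδ'])
    (by
      intro x
      refine (M.δ_finite x.1).subset ?_
      intro k hk h0
      apply hk
      ext1
      exact h0)
    (by
      intro x
      ext1
      refine (S.subtype.toAddMonoidHom.map_finsum ?_).trans (M.δ_sum x.1)
      refine (M.δ_finite x.1).subset ?_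
      intro k hk h0
      apply hk
      ext1
      exact h0)
  refine ⟨N, S.subtype, S.subtype_injective, S.range_subtype, ?_⟩
  intro i x hx
  have hx : δ' x = Tw.single 𝒜 i x := hx
  rw [M.mem_iff]
  ext k
  change (δ' x k).1 = _
  rw [hx, Tw.single_apply, Tw.single_apply]
  split_ifs <;> rfl

theorem GradedInjective.ext_ker {E : GrMod A 𝒜} (hE : GradedInjective 𝒜 E) {G P : GrMod A 𝒜}
    (φ : G.carrier →ₗ[A] P.carrier) (hφ : IsGradedHom 𝒜 G P φ)
    (g : G.carrier →ₗ[A] E.carrier) (hg : IsGradedHom 𝒜 G E g)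
    (hk : ∀ x, φ x = 0 → g x = 0) :
    ∃ h : P.carrier →ₗ[A] E.carrier, IsGradedHom 𝒜 P E h ∧ ∀ x, h (φ x) = g x := by
  obtain ⟨Q, π, hπ, hker, hπg⟩ := exists_quot G (LinearMap.ker φ) (by
    intro x hx k
    rw [LinearMap.mem_ker] at *
    rw [← isGradedHom_iff.1 hφ, hx]; simp)
  have hker' : ∀ x, π x = 0 ↔ φ x = 0 := by
    intro x
    rw [← LinearMap.mem_ker, hker, LinearMap.mem_ker]
  obtain ⟨φ', hφ'⟩ := exists_factor π hπ φ (fun x hx => (hker' x).1 hx)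
  obtain ⟨g', hg'⟩ := exists_factor π hπ g (fun x hx => hk x ((hker' x).1 hx))
  obtain ⟨h, hh1, hh2⟩ := hE Q P φ' (by
      rw [injective_iff_map_eq_zero]
      intro x hx
      obtain ⟨y, rfl⟩ := hπ x
      rw [hφ'] at hx
      exact (hker' y).2 hx) (factor_graded π hπ hπg φ hφ φ' hφ') g' (factor_graded π hπ hπg g hg g' hg')
  refine ⟨h, hh1, fun x => ?_⟩
  rw [← hφ', ← hg', ← hh2]; rfl

end objects


section modside
open CategoryTheory

theorem mk_ses {X Y Z : Type u} [AddCommGroup X] [AddCommGroup Y] [AddCommGroup Z]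
    [Module A X] [Module A Y] [Module A Z] (f : X →ₗ[A] Y) (g : Y →ₗ[A] Z)
    (hf : Function.Injective f) (hg : Function.Surjective g)
    (h0 : ∀ x, g (f x) = 0) (h : ∀ y, g y = 0 → ∃ x, f x = y) :
    (ShortComplex.moduleCatMk f g (LinearMap.ext h0)).ShortExact := by
  have h1 : Mono (ShortComplex.moduleCatMk f g (LinearMap.ext h0)).f :=
    (ModuleCat.mono_iff_injective _).2 hf
  have h2 : Epi (ShortComplex.moduleCatMk f g (LinearMap.ext h0)).g :=
    (ModuleCat.epi_iff_surjective _).2 hg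
  exact { exact := (ShortComplex.moduleCat_exact_iff _).2 h }

theorem has_of_inj {X : Type u} [AddCommGroup X] [Module A X] (h : Module.Injective A X) (n : ℕ) :
    HasInjectiveDimensionLT (ModuleCat.of A X) (n + 1) := by
  have := (Module.injective_iff_injective_object A X).1 h
  exact hasInjectiveDimensionLT_of_ge _ 1 _ (by omega)

theorem modInj_iff (n : ℕ) : ∀ X : ModuleCat.{u} A,
    modInjDimLE A n X ↔ HasInjectiveDimensionLT X (n + 1) := by
  induction n with
  | zero =>
    intro X
    rw [← injective_iff_hasInjectiveDimensionLT_one]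
    exact Module.injective_iff_injective_object A X
  | succ n ih =>
    intro X
    have ses (I : ModuleCat.{u} A) (f : X →ₗ[A] I) (hf : Function.Injective f) :=
      mk_ses f (LinearMap.range f).mkQ hf (Submodule.mkQ_surjective _) (by simp)
        (by intro y hy; simpa using hy)
    constructor
    · rintro ⟨I, hI, f, hf, hQ⟩
      rw [ih] at hQ
      exact (ses I f hf).hasInjectiveDimensionLT_X₁ (n + 1) hQ (has_of_inj hI _)
    · intro h
      let I : ModuleCat.{u} A := Injective.under X
      let f : X ⟶ I := Injective.ι X
      have hf : Function.Injective f.hom := (ModuleCat.mono_iff_injective f).1 inferInstance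
      have hI : Module.Injective A I :=
        (Module.injective_iff_injective_object A I).2 (inferInstanceAs (Injective (Injective.under X)))
      refine ⟨I, hI, f.hom, hf, ?_⟩
      rw [ih]
      exact (ses I f.hom hf).hasInjectiveDimensionLT_X₃ (n + 1) (has_of_inj hI _) h

theorem modInj_prod (n : ℕ) (J Q : Type u) [AddCommGroup J] [AddCommGroup Q] [Module A J]
    [Module A Q] (hJ : Module.Injective A J) (hQ : modInjDimLE A n (ModuleCat.of A Q)) :
    modInjDimLE A n (ModuleCat.of A (J × Q)) := by
  rw [modInj_iff] at *
  exact (mk_ses (LinearMap.inl A J Q) (LinearMap.snd A J Q) LinearMap.inl_injective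
    LinearMap.snd_surjective (by simp) (by
      rintro ⟨a, b⟩ h
      exact ⟨a, by simp at h; simp [h]⟩)).hasInjectiveDimensionLT_X₂ (n + 1) (has_of_inj hJ n) hQ

end modside

section claim1
variable [GradedRing 𝒜]
variable {𝒜}

theorem IsGradedHom.comp {M N P : GrMod A 𝒜} {g : N.carrier →ₗ[A] P.carrier}
    {f : M.carrier →ₗ[A] N.carrier} (hg : IsGradedHom 𝒜 N P g) (hf : IsGradedHom 𝒜 M N f) :
    IsGradedHom 𝒜 M P (g ∘ₗ f) := fun i x hx => hg i _ (hf i x hx)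

theorem IsGradedHom.add {M N : GrMod A 𝒜} {g : M.carrier →ₗ[A] N.carrier}
    {f : M.carrier →ₗ[A] N.carrier} (hg : IsGradedHom 𝒜 M N g) (hf : IsGradedHom 𝒜 M N f) :
    IsGradedHom 𝒜 M N (g + f) := fun i x hx => add_mem (hg i _ hx) (hf i x hx)

theorem IsGradedHom.sub {M N : GrMod A 𝒜} {g : M.carrier →ₗ[A] N.carrier}
    {f : M.carrier →ₗ[A] N.carrier} (hg : IsGradedHom 𝒜 M N g) (hf : IsGradedHom 𝒜 M N f) :
    IsGradedHom 𝒜 M N (g - f) := fun i x hx => sub_mem (hg i _ hx) (hf i x hx)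

theorem IsGradedHom.id (M : GrMod A 𝒜) : IsGradedHom 𝒜 M M LinearMap.id := fun _ _ hx => hx

theorem gr_of_retract (n : ℕ) : ∀ (M : GrMod A 𝒜) (X : ModuleCat.{u} A), modInjDimLE A n X →
    ∀ (i : M.carrier →ₗ[A] (RX 𝒜 X).carrier) (r : (RX 𝒜 X).carrier →ₗ[A] M.carrier),
    IsGradedHom 𝒜 _ _ i → IsGradedHom 𝒜 _ _ r → (∀ x, r (i x) = x) → grInjDimLE 𝒜 n M := by
  induction n with
  | zero =>
    intro M X hX i r hi hr hri N P ι hι hιg g hg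
    obtain ⟨h, hh1, hh2⟩ := RX.gradedInjective (𝒜 := 𝒜) (X := X) hX N P ι hι hιg (i ∘ₗ g) (hi.comp hg)
    refine ⟨r ∘ₗ h, hr.comp hh1, ?_⟩
    rw [LinearMap.comp_assoc, hh2]
    ext x
    simp [hri]
  | succ n ih =>
    rintro M X ⟨J, hJ, f, hf, hQ⟩ i r hi hr hri
    have hRJ := RX.gradedInjective (𝒜 := 𝒜) (X := J) hJ
    have hmf : Function.Injective (RX.map (𝒜 := 𝒜) f) := RX.map_injective f hf
    have hii : Function.Injective i := Function.LeftInverse.injective hri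
    let F : M.carrier →ₗ[A] (RX 𝒜 J).carrier := RX.map f ∘ₗ i
    have hF : Function.Injective F := hmf.comp hii
    have hFg : IsGradedHom 𝒜 _ _ F := (RX.map_graded f).comp hi
    obtain ⟨Q, π, hπ, hker, hπg⟩ := exists_quot (RX 𝒜 J) (LinearMap.range F) (by
      rintro _ ⟨m, rfl⟩ k
      rw [isGradedHom_iff.1 hFg]
      exact ⟨_, rfl⟩)
    have hker' : ∀ x, π x = 0 ↔ ∃ m, F m = x := by
      intro x
      rw [← LinearMap.mem_ker, hker]; rfl
    refine ⟨RX 𝒜 J, hRJ, F, hF, hFg, Q, π, hπ, hker, hπg, ?_⟩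
    obtain ⟨e, heg, he⟩ := hRJ _ _ (RX.map (𝒜 := 𝒜) f) hmf (RX.map_graded f)
      (RX.map f ∘ₗ i ∘ₗ r) ((RX.map_graded f).comp (hi.comp hr))
    have he : ∀ x, e (RX.map f x) = RX.map f (i (r x)) := fun x => LinearMap.congr_fun he x
    let q : J →ₗ[A] (J ⧸ LinearMap.range f) := (LinearMap.range f).mkQ
    have hq : Function.Surjective q := Submodule.mkQ_surjective _
    have hqf : ∀ x, q (f x) = 0 := by intro x; simp [q]
    obtain ⟨s, hs⟩ := exists_factor π hπ (LinearMap.id - e) (by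
      intro x hx
      obtain ⟨m, rfl⟩ := (hker' x).1 hx
      simp [F, he, hri])
    have hsg := factor_graded π hπ hπg _ ((IsGradedHom.id _).sub heg) s hs
    obtain ⟨v, hv⟩ := exists_factor π hπ (RX.map q) (by
      intro x hx
      obtain ⟨m, rfl⟩ := (hker' x).1 hx
      apply RX.ext; intro k
      simp [F, hqf])
    have hvg := factor_graded π hπ hπg _ (RX.map_graded q) v hv
    obtain ⟨w, hw⟩ := exists_factor (RX.map (𝒜 := 𝒜) q) (RX.map_surjective q hq) (π ∘ₗ e) (by
      intro x hx
      obtain ⟨y, rfl⟩ := RX.map_exact f q hf (by intro y hy; simpa [q] using hy) x hx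
      rw [LinearMap.comp_apply, he, hker']
      exact ⟨_, rfl⟩)
    have hwg := factor_graded _ (RX.map_surjective q hq) (RX.map_graded q) _ (hπg.comp heg) w hw
    refine ih Q (ModuleCat.of A (J × (J ⧸ LinearMap.range f))) (modInj_prod n _ _ hJ hQ)
      (RX.map (LinearMap.inl A _ _) ∘ₗ s + RX.map (LinearMap.inr A _ _) ∘ₗ v)
      (π ∘ₗ RX.map (LinearMap.fst A _ _) + w ∘ₗ RX.map (LinearMap.snd A _ _))
      (((RX.map_graded _).comp hsg).add ((RX.map_graded _).comp hvg))
      ((hπg.comp (RX.map_graded _)).add (hwg.comp (RX.map_graded _))) ?_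
    intro x
    obtain ⟨z, rfl⟩ := hπ x
    have e1 : RX.map (LinearMap.fst A J (J ⧸ LinearMap.range f))
        (RX.map (LinearMap.inl A J (J ⧸ LinearMap.range f)) (s (π z)) +
          RX.map (LinearMap.inr A J (J ⧸ LinearMap.range f)) (v (π z))) = s (π z) := by
      apply RX.ext; intro k
      simp
    have e2 : RX.map (LinearMap.snd A J (J ⧸ LinearMap.range f))
        (RX.map (LinearMap.inl A J (J ⧸ LinearMap.range f)) (s (π z)) +
          RX.map (LinearMap.inr A J (J ⧸ LinearMap.range f)) (v (π z))) = v (π z) := by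
      apply RX.ext; intro k
      simp
    refine (congrArg₂ (fun a b => π a + w b) e1 e2).trans ?_
    rw [hs, hv, hw]
    simp

theorem claim1 (n : ℕ) (M : GrMod A 𝒜) (h : modInjDimLE A n (ModuleCat.of A M.carrier)) :
    grInjDimLE 𝒜 n M :=
  gr_of_retract n M (ModuleCat.of A M.carrier) h (RX.lift M LinearMap.id) (RX.retr M)
    (RX.lift_graded M _) (RX.retr_graded M) (RX.retr_lift M)

end claim1


section claim2
variable [GradedRing 𝒜]

/-- `A` as a graded module over itself -/
noncomputable def AG : GrMod A 𝒜 where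
  carrier := A
  grading := 𝒜
  internal := DirectSum.Decomposition.isInternal 𝒜
  smul_mem := by
    intro i j a ha x hx
    exact SetLike.mul_mem_graded ha hx

/-- homogeneous components -/
noncomputable def gcmp : A →ₗ[A] Tw 𝒜 A := (AG 𝒜).δ

theorem gcmp_mem (a : A) (i : ℤ) : gcmp 𝒜 a i ∈ 𝒜 i := (AG 𝒜).δ_mem a i

theorem gcmp_of_mem {a : A} {i : ℤ} (ha : a ∈ 𝒜 i) : gcmp 𝒜 a = Tw.single 𝒜 i a :=
  (AG 𝒜).mem_iff.1 ha

theorem gcmp_finite (a : A) : (Function.support (gcmp 𝒜 a).fn).Finite := (AG 𝒜).δ_finite a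

theorem gcmp_sum (a : A) : ∑ i ∈ (gcmp_finite 𝒜 a).toFinset, gcmp 𝒜 a i = a := by
  have h : ∑ᶠ i, gcmp 𝒜 a i = a := (AG 𝒜).δ_sum a
  rw [← finsum_eq_sum_of_support_toFinset_subset _ (gcmp_finite 𝒜 a) le_rfl]
  exact h

theorem gcmp_mul {a : A} {i : ℤ} (ha : a ∈ 𝒜 i) (b : A) (k : ℤ) :
    gcmp 𝒜 (a * b) k = a * gcmp 𝒜 b (k - i) := by
  rw [← smul_eq_mul, map_smul, Tw.smul_hom ha]; rfl

theorem gcmp_one : gcmp 𝒜 (1 : A) = Tw.single 𝒜 0 1 := gcmp_of_mem 𝒜 SetLike.GradedOne.one_mem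

variable {𝒜}
theorem smul_apply_zero {X : Type*} [AddCommGroup X] [Module A X] (b : A) (x : Tw 𝒜 X) (e : ℤ)
    (h : ∀ i, gcmp 𝒜 b i ≠ 0 → x (e - i) = 0) : (b • x) e = 0 := by
  rw [← gcmp_sum 𝒜 b, Finset.sum_smul, ← Tw.pr_apply, map_sum]
  apply Finset.sum_eq_zero
  intro i hi
  rw [Tw.pr_apply, Tw.smul_hom (gcmp_mem 𝒜 b i), h i (by simpa using hi), smul_zero]

variable (𝒜)
section AR
variable (σ : ℤ)
open Polynomial

/-- homogenization -/
noncomputable def hmg (p : A × ℤ) : A[X] :=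
  ∑ i ∈ (gcmp_finite 𝒜 p.1).toFinset, monomial (σ * i - p.2).toNat (gcmp 𝒜 p.1 i)

/-- partial dehomogenization -/
noncomputable def dhm (e : ℤ) : A[X] →ₗ[ℤ] A :=
  Polynomial.lsum (fun j =>
    ((Tw.pr 𝒜 A (σ * (e + j))).comp (gcmp 𝒜).toAddMonoidHom).toIntLinearMap)

theorem dhm_monomial (e : ℤ) (j : ℕ) (c : A) :
    dhm 𝒜 σ e (monomial j c) = gcmp 𝒜 c (σ * (e + j)) := by
  rw [dhm, Polynomial.lsum_apply, Polynomial.sum_monomial_index]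
  · rfl
  · simp

theorem dhm_mul (hσ : σ * σ = 1) (e : ℤ) (q : A × ℤ) (hq : ∀ i, σ * i < q.2 → gcmp 𝒜 q.1 i = 0)
    (p : A[X]) : dhm 𝒜 σ e (p * hmg 𝒜 σ q) = dhm 𝒜 σ (e - q.2) p * q.1 := by
  induction p using Polynomial.induction_on' with
  | add p r hp hr => rw [add_mul, map_add, hp, hr, map_add, add_mul]
  | monomial j c =>
    rw [dhm_monomial, hmg, Finset.mul_sum, map_sum]
    conv_rhs => rw [← gcmp_sum 𝒜 q.1]
    rw [Finset.mul_sum]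
    apply Finset.sum_congr rfl
    intro i hi
    have hi' : q.2 ≤ σ * i := by
      by_contra h
      push Not at h
      simp [hq i h] at hi
    rw [monomial_mul_monomial, dhm_monomial, mul_comm c, gcmp_mul 𝒜 (gcmp_mem 𝒜 _ _), mul_comm]
    congr 2
    push_cast
    rw [Int.toNat_of_nonneg (by omega)]
    linear_combination i * hσ

theorem dhm_ge (hσ : σ * σ = 1) (e : ℤ) (p : A[X]) (i : ℤ) (hi : σ * i < e) :
    gcmp 𝒜 (dhm 𝒜 σ e p) i = 0 := by
  induction p using Polynomial.induction_on' with
  | add p r hp hr => rw [map_add, map_add, Tw.add_apply, hp, hr, add_zero]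
  | monomial j c =>
    rw [dhm_monomial, gcmp_of_mem 𝒜 (gcmp_mem 𝒜 _ _), Tw.single_apply, if_neg]
    rintro rfl
    rw [← mul_assoc, hσ] at hi
    omega

theorem artin_rees [IsNoetherianRing A] (hσ : σ * σ = 1) (I : Ideal A) :
    ∃ s : Finset (A × ℤ), (∀ p ∈ s, p.1 ∈ I) ∧
      ∀ N : ℤ, ∀ c ∈ I, (∀ i, σ * i < N → gcmp 𝒜 c i = 0) →
        ∃ b : A × ℤ → A, c = ∑ p ∈ s, b p * p.1 ∧
          ∀ p ∈ s, ∀ i, σ * i < N - p.2 → gcmp 𝒜 (b p) i = 0 := by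
  classical
  let S : Set (A × ℤ) := {q | q.1 ∈ I ∧ ∀ i, σ * i < q.2 → gcmp 𝒜 q.1 i = 0}
  obtain ⟨t, ht, hspan⟩ := (Submodule.fg_span_iff_fg_span_finset_subset (hmg 𝒜 σ '' S)).1
    (IsNoetherian.noetherian (R := A[X]) _)
  obtain ⟨s, hs, rfl⟩ := Finset.subset_set_image_iff.1 ht
  refine ⟨s, fun p hp => (hs hp).1, ?_⟩
  intro N c hc hN
  have hmem : hmg 𝒜 σ (c, N) ∈ Submodule.span A[X] (hmg 𝒜 σ '' S) :=
    Submodule.subset_span ⟨(c, N), ⟨hc, hN⟩, rfl⟩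
  rw [hspan, Finset.coe_image, Submodule.mem_span_image_finset_iff_exists_fun] at hmem
  obtain ⟨g0, hg0⟩ := hmem
  obtain ⟨g, hg⟩ : ∃ g : A × ℤ → A[X], ∑ p ∈ s, g p • hmg 𝒜 σ p = hmg 𝒜 σ (c, N) := by
    refine ⟨fun p => if h : p ∈ s then g0 ⟨p, h⟩ else 0, ?_⟩
    rw [← hg0, ← Finset.sum_coe_sort s]
    apply Finset.sum_congr rfl
    intro p _
    simp
  refine ⟨fun p => dhm 𝒜 σ (N - p.2) (g p), ?_, fun p hp i hi => dhm_ge 𝒜 σ hσ _ _ _ hi⟩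
  have h1 := congrArg (dhm 𝒜 σ N) hg
  rw [map_sum] at h1
  have h2 : dhm 𝒜 σ N (hmg 𝒜 σ (c, N)) = c := by
    rw [← one_mul (hmg 𝒜 σ (c, N)), dhm_mul 𝒜 σ hσ N (c, N) hN, ← monomial_zero_one,
      dhm_monomial]
    simp [gcmp_one]
  rw [h2] at h1
  rw [← h1]
  apply Finset.sum_congr rfl
  intro p hp
  rw [smul_eq_mul, dhm_mul 𝒜 σ hσ N p (hs hp).2]

end AR

variable {𝒜}

/-- product of the graded pieces -/
def hat (E : GrMod A 𝒜) : Submodule A (Tw 𝒜 E.carrier) where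
  carrier := {x | ∀ i, x i ∈ E.grading i}
  zero_mem' := fun i => zero_mem _
  add_mem' := fun hx hy i => add_mem (hx i) (hy i)
  smul_mem' := by
    intro a x hx i
    induction a using hom_induction (𝒜 := 𝒜) with
    | h0 => rw [zero_smul]; exact zero_mem _
    | h1 k a ha =>
      rw [Tw.smul_hom ha]
      have := E.smul_mem k (i - k) a ha _ (hx (i - k))
      rwa [add_sub_cancel] at this
    | h2 a b iha ihb => rw [add_smul]; exact add_mem iha ihb

/-- one-sided products -/
def half (σ : ℤ) (E : GrMod A 𝒜) : Submodule A (Tw 𝒜 E.carrier) where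
  carrier := {x | x ∈ hat E ∧ ∃ d, ∀ i, σ * i < d → x i = 0}
  zero_mem' := ⟨zero_mem _, 0, fun _ _ => rfl⟩
  add_mem' := by
    rintro x y ⟨hx, d, hd⟩ ⟨hy, d', hd'⟩
    refine ⟨add_mem hx hy, min d d', fun i hi => ?_⟩
    rw [Tw.add_apply, hd i (by omega), hd' i (by omega), add_zero]
  smul_mem' := by
    rintro a x ⟨hx, hd⟩
    refine ⟨(hat E).smul_mem a hx, ?_⟩
    induction a using hom_induction (𝒜 := 𝒜) with
    | h0 => rw [zero_smul]; exact ⟨0, fun _ _ => rfl⟩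
    | h1 k a ha =>
      obtain ⟨d, hd⟩ := hd
      refine ⟨d + σ * k, fun i hi => ?_⟩
      rw [Tw.smul_hom ha, hd, smul_zero]
      rw [mul_sub]; omega
    | h2 a b iha ihb =>
      obtain ⟨d, hd⟩ := iha
      obtain ⟨d', hd'⟩ := ihb
      refine ⟨min d d', fun i hi => ?_⟩
      rw [add_smul, Tw.add_apply, hd i (by omega), hd' i (by omega), add_zero]

/-- the adjunction -/
noncomputable def RX.co {Y Z : Type u} [AddCommGroup Y] [Module A Y] [AddCommGroup Z] [Module A Z]
    (H : (RX 𝒜 Y).carrier →ₗ[A] Z) : Y →ₗ[A] Tw 𝒜 Z :=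
  mkLin 𝒜 (Tw.lift 𝒜 (fun k => H.toAddMonoidHom.comp (RX.single 𝒜 k))) (by
    intro i a ha y
    ext k
    rw [Tw.smul_hom ha]
    change H (RX.single 𝒜 k (a • y)) = a • H (RX.single 𝒜 (k - i) y)
    rw [← map_smul, RX.smul_single ha, add_sub_cancel])

theorem RX.co_apply {Y Z : Type u} [AddCommGroup Y] [Module A Y] [AddCommGroup Z] [Module A Z]
    (H : (RX 𝒜 Y).carrier →ₗ[A] Z) (y : Y) (k : ℤ) : RX.co H y k = H (RX.single 𝒜 k y) := rfl

/-- the other direction of the adjunction -/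
noncomputable def RX.coinv {Y : Type u} [AddCommGroup Y] [Module A Y] {E : GrMod A 𝒜}
    (g : Y →ₗ[A] Tw 𝒜 E.carrier) : (RX 𝒜 Y).carrier →ₗ[A] E.carrier :=
  RX.sum (fun k => (Tw.pr 𝒜 E.carrier k).comp g.toAddMonoidHom) (by
    intro i a ha k y
    change g (a • y) (i + k) = a • g y k
    rw [map_smul, Tw.smul_hom ha, add_sub_cancel_left])

theorem RX.coinv_apply {Y : Type u} [AddCommGroup Y] [Module A Y] {E : GrMod A 𝒜}
    (g : Y →ₗ[A] Tw 𝒜 E.carrier) (x : (RX 𝒜 Y).carrier) :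
    RX.coinv g x = ∑ᶠ k, g (RX.val x k) k := rfl

theorem RX.coinv_single {Y : Type u} [AddCommGroup Y] [Module A Y] {E : GrMod A 𝒜}
    (g : Y →ₗ[A] Tw 𝒜 E.carrier) (k : ℤ) (y : Y) :
    RX.coinv g (RX.single 𝒜 k y) = g y k := RX.sum_single _ _ k y

theorem RX.coinv_graded {Y : Type u} [AddCommGroup Y] [Module A Y] {E : GrMod A 𝒜}
    (g : Y →ₗ[A] Tw 𝒜 E.carrier) (hg : ∀ y, g y ∈ hat E) : IsGradedHom 𝒜 _ _ (RX.coinv g) :=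
  RX.sum_graded _ _ _ (fun k y => hg y k)

theorem hat_injective {E : GrMod A 𝒜} (hE : GradedInjective 𝒜 E) : Module.Injective A (hat E) := by
  constructor
  intro X Y _ _ _ _ f hf g
  obtain ⟨H, hHg, hH⟩ := hE _ _ (RX.map (𝒜 := 𝒜) f) (RX.map_injective f hf) (RX.map_graded f)
    (RX.coinv ((hat E).subtype ∘ₗ g)) (RX.coinv_graded _ (fun y => (g y).2))
  refine ⟨LinearMap.codRestrict (hat E) (RX.co H) (fun y i => hHg i _ (RX.single_mem i y)), ?_⟩
  intro x
  ext1
  ext k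
  change H (RX.single 𝒜 k (f x)) = (g x).1 k
  rw [← RX.map_single, ← LinearMap.comp_apply, hH, RX.coinv_single]
  rfl

theorem half_injective [IsNoetherianRing A] (σ : ℤ) (hσ : σ * σ = 1) {E : GrMod A 𝒜}
    (hE : GradedInjective 𝒜 E) : Module.Injective A (half σ E) := by
  classical
  apply Module.Baer.injective
  intro I g
  obtain ⟨f, hf⟩ := (hat_injective hE).out I.subtype I.subtype_injective
    (LinearMap.codRestrict (hat E) ((half σ E).subtype ∘ₗ g) (fun y => (g y).2.1))
  let x : Tw 𝒜 E.carrier := (f 1).1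
  have hx : x ∈ hat E := (f 1).2
  have hgx : ∀ a : I, a.1 • x = (g a).1 := by
    intro a
    have h1 := hf a
    have h2 : f (I.subtype a) = a.1 • f 1 := by rw [← map_smul]; simp
    rw [h2] at h1
    exact congrArg Subtype.val h1
  obtain ⟨s, hsI, hs⟩ := artin_rees 𝒜 σ hσ I
  have hd : ∀ p : A × ℤ, ∃ d, p ∈ s → ∀ i, σ * i < d → (p.1 • x) i = 0 := by
    intro p
    by_cases hp : p ∈ s
    · obtain ⟨d, hd⟩ := (g ⟨p.1, hsI p hp⟩).2.2
      refine ⟨d, fun _ i hi => ?_⟩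
      rw [hgx ⟨p.1, hsI p hp⟩]
      exact hd i hi
    · exact ⟨0, fun h => absurd h hp⟩
  choose d hd using hd
  obtain ⟨D, hD⟩ := (s.image (fun p => d p - p.2)).bddBelow
  have hD : ∀ p ∈ s, D ≤ d p - p.2 := fun p hp =>
    hD (Finset.mem_coe.2 (Finset.mem_image_of_mem _ hp))
  -- the key vanishing
  have key : ∀ c ∈ I, ∀ e, (∀ i, σ * i < σ * e - D + 1 → gcmp 𝒜 c i = 0) → (c • x) e = 0 := by
    intro c hc e h
    obtain ⟨b, hcb, hb⟩ := hs _ c hc h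
    rw [hcb, Finset.sum_smul, ← Tw.pr_apply, map_sum]
    apply Finset.sum_eq_zero
    intro p hp
    rw [mul_smul, Tw.pr_apply]
    apply smul_apply_zero
    intro i hi
    apply hd p hp
    have h1 : ¬ (σ * i < σ * e - D + 1 - p.2) := fun h => hi (hb p hp i h)
    have h2 := hD p hp
    rw [mul_sub]
    omega
  let G' : Submodule A (RX 𝒜 A).carrier :=
    { carrier := {p | ∀ e i, σ * i ≤ σ * e - D → gcmp 𝒜 (RX.val p e) i = 0}
      zero_mem' := by intro e i _; simp
      add_mem' := by
        intro p q hp hq e i h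
        rw [map_add, Tw.add_apply, map_add, Tw.add_apply, hp e i h, hq e i h, add_zero]
      smul_mem' := by
        intro a p hp
        induction a using hom_induction (𝒜 := 𝒜) with
        | h0 => intro e i _; simp
        | h1 k a ha =>
          intro e i h
          rw [map_smul, Tw.smul_hom ha, map_smul, Tw.smul_hom ha, hp, smul_zero]
          rw [mul_sub, mul_sub]; omega
        | h2 a b iha ihb =>
          intro e i h
          rw [add_smul, map_add, Tw.add_apply, map_add, Tw.add_apply, iha e i h, ihb e i h,
            add_zero] }
  obtain ⟨G, ι, hι, hrange, hιg⟩ := exists_sub (RX 𝒜 A) G' (by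
    intro p hp k e i h
    rw [RX.val_δ, Tw.single_apply]
    split_ifs with hek
    · subst hek; exact hp e i h
    · simp)
  have hιG : ∀ z, ι z ∈ G' := fun z => hrange ▸ ⟨z, rfl⟩
  let tx : A →ₗ[A] Tw 𝒜 E.carrier := LinearMap.toSpanSingleton A _ x
  obtain ⟨h, hhg, hh⟩ := hE.ext_ker (RX.map I.mkQ ∘ₗ ι) ((RX.map_graded _).comp hιg)
    (RX.coinv tx ∘ₗ ι) ((RX.coinv_graded tx (fun y => (hat E).smul_mem y hx)).comp hιg) (by
      intro z hz
      rw [LinearMap.comp_apply, RX.coinv_apply]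
      have : ∀ k, tx (RX.val (ι z) k) k = 0 := by
        intro k
        apply key
        · have : RX.val (RX.map I.mkQ (ι z)) k = 0 := by
            rw [LinearMap.comp_apply] at hz
            rw [hz]; simp
          exact (Submodule.Quotient.mk_eq_zero I).1 this
        · intro i hi
          exact hιG z k i (by omega)
      simp [this])
  let y : Tw 𝒜 E.carrier := RX.co h (I.mkQ 1)
  have hy : y ∈ hat E := fun i => hhg i _ (RX.single_mem i _)
  have hIy : ∀ a ∈ I, a • y = 0 := by
    intro a ha
    have : I.mkQ a = 0 := (Submodule.Quotient.mk_eq_zero I).2 ha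
    change a • RX.co h (I.mkQ 1) = 0
    rw [← map_smul, ← map_smul, smul_eq_mul, mul_one, this, map_zero]
  have hxy : ∀ j, σ * j < D → y j = x j := by
    intro j hj
    have hmem : RX.single 𝒜 j (1 : A) ∈ G' := by
      intro e i hi
      rw [RX.val_single_apply]
      split_ifs with hej
      · subst hej
        rw [gcmp_one, Tw.single_apply, if_neg]
        rintro rfl
        simp at hi
        omega
      · simp
    rw [← hrange] at hmem
    obtain ⟨z, hz⟩ := hmem
    have := hh z
    rw [LinearMap.comp_apply, LinearMap.comp_apply, hz, RX.map_single, RX.coinv_single] at this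
    change h (RX.single 𝒜 j (I.mkQ 1)) = _
    rw [this]
    simp [tx]
  have hmem : x - y ∈ half σ E := by
    refine ⟨sub_mem hx hy, D, fun i hi => ?_⟩
    rw [Tw.sub_apply, hxy i hi, sub_self]
  refine ⟨LinearMap.toSpanSingleton A _ ⟨x - y, hmem⟩, fun a ha => ?_⟩
  ext1
  change a • (x - y) = _
  rw [smul_sub, hIy a ha, sub_zero, hgx ⟨a, ha⟩]

open CategoryTheory in
theorem has_of_graded [IsNoetherianRing A] {E : GrMod A 𝒜} (hE : GradedInjective 𝒜 E) :
    HasInjectiveDimensionLT (ModuleCat.of A E.carrier) 2 := by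
  classical
  have hδ : ∀ x, E.δ x ∈ hat E := fun x i => E.δ_mem x i
  have hb : ∀ (σ : ℤ) (x : E.carrier), E.δ x ∈ half σ E := by
    intro σ x
    refine ⟨hδ x, ?_⟩
    obtain ⟨D, hD⟩ := ((E.δ_finite x).toFinset.image (fun i => σ * i)).bddBelow
    refine ⟨D, fun i hi => ?_⟩
    by_contra h
    have : D ≤ σ * i :=
      hD (Finset.mem_coe.2 (Finset.mem_image_of_mem (fun i => σ * i) (by simpa using h)))
    omega
  let f : E.carrier →ₗ[A] half 1 E × half (-1) E :=
    (LinearMap.codRestrict _ E.δ (hb 1)).prod (LinearMap.codRestrict _ E.δ (hb (-1)))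
  let i1 : half 1 E →ₗ[A] hat E :=
    Submodule.inclusion (fun x hx => hx.1)
  let i2 : half (-1) E →ₗ[A] hat E :=
    Submodule.inclusion (fun x hx => hx.1)
  let g : half 1 E × half (-1) E →ₗ[A] hat E :=
    i1 ∘ₗ LinearMap.fst A _ _ - i2 ∘ₗ LinearMap.snd A _ _
  have hf : Function.Injective f := by
    intro a b h
    have : E.δ a = E.δ b := congrArg (fun z => (z.1 : Tw 𝒜 E.carrier)) h
    rw [← E.δ_sum a, ← E.δ_sum b, this]
  have hg : Function.Surjective g := by
    intro x
    refine ⟨(⟨⟨fun i => if 0 ≤ i then x.1 i else 0⟩, ?_, 0, ?_⟩,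
      ⟨⟨fun i => if 0 ≤ i then 0 else - x.1 i⟩, ?_, 0, ?_⟩), ?_⟩
    · intro i
      change (if 0 ≤ i then x.1 i else 0) ∈ _
      split_ifs
      · exact x.2 i
      · exact zero_mem _
    · intro i hi
      exact if_neg (by omega)
    · intro i
      change (if 0 ≤ i then 0 else - x.1 i) ∈ _
      split_ifs
      · exact zero_mem _
      · exact neg_mem (x.2 i)
    · intro i hi
      exact if_pos (by omega)
    · ext1
      ext i
      change (if 0 ≤ i then x.1 i else 0) - (if 0 ≤ i then 0 else - x.1 i) = x.1 i
      split_ifs <;> simp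
  have h0 : ∀ x, g (f x) = 0 := by
    intro x
    ext1
    change E.δ x - E.δ x = 0
    simp
  have hex : ∀ y, g y = 0 → ∃ x, f x = y := by
    rintro ⟨⟨p, hp, d, hd⟩, ⟨q, hq, d', hd'⟩⟩ h
    have hpq : p - q = 0 := congrArg Subtype.val h
    have hpq : p = q := sub_eq_zero.1 hpq
    subst hpq
    have hfin : (Function.support p.fn).Finite := by
      refine (Set.finite_Icc d (-d')).subset ?_
      intro i hi
      constructor
      · by_contra h
        exact hi (hd i (by omega))
      · by_contra h
        exact hi (hd' i (by omega))
    have hδp : E.δ (∑ i ∈ hfin.toFinset, p i) = p := by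
      ext k
      rw [map_sum, ← Tw.pr_apply, map_sum]
      have : ∀ i, Tw.pr 𝒜 E.carrier k (E.δ (p i)) = if k = i then p i else 0 := by
        intro i
        rw [E.mem_iff.1 (hp i), Tw.pr_apply, Tw.single_apply]
      simp only [this, Finset.sum_ite_eq]
      split_ifs with h
      · rfl
      · simpa [eq_comm] using h
    exact ⟨_, Prod.ext (Subtype.ext hδp) (Subtype.ext hδp)⟩
  have hprod : HasInjectiveDimensionLT (ModuleCat.of A (half 1 E × half (-1) E)) 2 :=
    (modInj_iff 1 _).1 (modInj_prod 1 _ _ (half_injective 1 (by norm_num) hE)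
      ((modInj_iff 1 _).2 (has_of_inj (half_injective (-1) (by norm_num) hE) 1)))
  exact (mk_ses f g hf hg h0 hex).hasInjectiveDimensionLT_X₁ 1
    (has_of_inj (hat_injective hE) 0) hprod

open CategoryTheory in
theorem claim2 [IsNoetherianRing A] (n : ℕ) : ∀ M : GrMod A 𝒜, grInjDimLE 𝒜 n M →
    HasInjectiveDimensionLT (ModuleCat.of A M.carrier) (n + 2) := by
  induction n with
  | zero => intro M hM; exact has_of_graded hM
  | succ n ih =>
    rintro M ⟨I, hI, f, hf, -, Q, π, hπ, hker, -, hQ⟩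
    have h1 := ih Q hQ
    have h2 := has_of_graded hI
    have h3 : HasInjectiveDimensionLT (ModuleCat.of A I.carrier) (n + 2 + 1) :=
      hasInjectiveDimensionLT_of_ge _ 2 _ (by omega)
    have hk : ∀ x, π x = 0 ↔ ∃ m, f m = x := by
      intro x
      rw [← LinearMap.mem_ker, hker]; rfl
    exact (mk_ses f π hf hπ (fun x => (hk _).2 ⟨x, rfl⟩) (fun y hy => (hk y).1 hy)).hasInjectiveDimensionLT_X₁
      (n + 2) h1 h3

end claim2


theorem graded_vs_ungraded_injective_dimension
    [GradedRing 𝒜] [IsNoetherianRing A]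
    (M : GrMod A 𝒜) (hfg : Module.Finite A M.carrier) :
    -- injdim_{Gr(A)} M ≤ injdim_{Mod(A)} M
    (∀ n : ℕ, modInjDimLE A n (ModuleCat.of A M.carrier) → grInjDimLE 𝒜 n M) ∧
    -- injdim_{Mod(A)} M ≤ injdim_{Gr(A)} M + 1
    (∀ n : ℕ, grInjDimLE 𝒜 n M → modInjDimLE A (n + 1) (ModuleCat.of A M.carrier)) ∧
    -- in particular, finiteness agrees
    ((∃ n, grInjDimLE 𝒜 n M) ↔ ∃ n, modInjDimLE A n (ModuleCat.of A M.carrier)) := by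
  refine ⟨fun n h => claim1 n M h, fun n h => (modInj_iff (n+1) _).2 (claim2 n M h), ?_, ?_⟩
  · rintro ⟨n, h⟩
    exact ⟨n+1, (modInj_iff (n+1) _).2 (claim2 n M h)⟩
  · rintro ⟨n, h⟩
    exact ⟨n, claim1 n M h⟩
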